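/- Let k be a positive integer and ε > 0, and set b(ε) = (ε/1000)^{2^{2k+2}} and n(ε) = ⌈10·ε^{−2^{k+1}}⌉. Let p be a prime, G_1, …, G_k finite-dimensional F_p-vector spaces, and f : G_1 × ⋯ × G_k → 𝔻 a function. Suppose μ_1, …, μ_n ∈ MLS_ε(f) are multilinear forms such that bias(μ_i − μ_j) ≤ b(ε) for every i ≠ j. Then n < n(ε). -/

import Mathlib

noncomputable section

namespace DGU

/-- `e^{2πi t/p}` for `t ∈ ℤ/p`. -/
def chi (p : ℕ) (t : ZMod p) : ℂ :=
  Complex.exp (2 * Real.pi * Complex.I * ((t.val : ℂ) / (p : ℂ)))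

/-- Average of a complex-valued function over a finite type. -/
def cavg {α : Type*} [Fintype α] (f : α → ℂ) : ℂ :=
  (∑ x, f x) / (Fintype.card α : ℂ)

/-- Average of a real-valued function over a finite type. -/
def ravg {α : Type*} [Fintype α] (f : α → ℝ) : ℝ :=
  (∑ x, f x) / (Fintype.card α : ℝ)

/-- Multiplicative discrete derivative. -/
def mder {G : Type*} [Add G] (u : G) (f : G → ℂ) : G → ℂ :=
  fun x => f (x + u) * (starRingEnd ℂ) (f x)

/-- Iterated multiplicative discrete derivative along a list of directions. -/
def mderList {G : Type*} [Add G] (l : List G) (f : G → ℂ) : G → ℂ :=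
  l.foldr mder f

/-- Additive discrete derivative. -/
def aderiv {G R : Type*} [Add G] [Sub R] (a : G) (F : G → R) : G → R :=
  fun x => F (x + a) - F x

/-- Iterated additive discrete derivative along a list of directions. -/
def aderivList {G R : Type*} [Add G] [Sub R] (l : List G) (F : G → R) : G → R :=
  l.foldr aderiv F

/-- `t`-fold iterated exponential. -/
def iterExp : ℕ → ℝ → ℝ
  | 0, x => x
  | t + 1, x => Real.exp (iterExp t x)

/-- `P : G → R` is a polynomial of degree at most `d`. -/
def IsPolyDegLE {G R : Type*} [Add G] [Sub R] [Zero R] (d : ℕ) (P : G → R) : Prop :=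
  ∀ (a : Fin (d + 1) → G) (x : G), aderivList (List.ofFn a) P x = 0

/-- `n`-fold complex conjugation. -/
def conjIter (n : ℕ) (z : ℂ) : ℂ := (starRingEnd ℂ)^[n] z

/-- Cubical convolution of a family of functions indexed by subsets of `[k]`. -/
def cubicalConv {k : ℕ} {G : Fin k → Type*} [∀ i, AddCommGroup (G i)] [∀ i, Fintype (G i)]
    (f : Finset (Fin k) → (∀ i, G i) → ℂ) : (∀ i, G i) → ℂ :=
  fun a => cavg (fun x : ∀ i, G i =>
    ∏ I : Finset (Fin k),
      conjIter (k - I.card) (f I (fun i => if i ∈ I then x i + a i else x i)))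

/-- A map on a product of `ℤ/p`-vector spaces is multiaffine if it is affine in each
variable separately. -/
def IsMultiaffine (p : ℕ) {k : ℕ} {G : Fin k → Type*} [∀ i, AddCommGroup (G i)]
    [∀ i, Module (ZMod p) (G i)] {W : Type*} [AddCommGroup W] [Module (ZMod p) W]
    (α : (∀ i, G i) → W) : Prop :=
  ∀ (d : Fin k) (x : ∀ i, G i), ∃ (L : G d →ₗ[ZMod p] W) (c : W),
    ∀ y : G d, α (Function.update x d y) = L y + c

/-- A function `ψ : A^m × G₁ × ⋯ × G_k → ℤ/p` which is linear in each of the `m + k`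
variables separately. -/
def MultilinearPair (p m k : ℕ) (A : Type*) [AddCommGroup A] [Module (ZMod p) A]
    (G : Fin k → Type*) [∀ i, AddCommGroup (G i)] [∀ i, Module (ZMod p) (G i)]
    (ψ : (Fin m → A) → (∀ j, G j) → ZMod p) : Prop :=
  (∀ (i : Fin m) (a : Fin m → A) (d : ∀ j, G j) (u v : A) (s t : ZMod p),
      ψ (Function.update a i (s • u + t • v)) d =
        s * ψ (Function.update a i u) d + t * ψ (Function.update a i v) d) ∧
  (∀ (j : Fin k) (a : Fin m → A) (d : ∀ l, G l) (u v : G j) (s t : ZMod p),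
      ψ a (Function.update d j (s • u + t • v)) =
        s * ψ a (Function.update d j u) + t * ψ a (Function.update d j v))

/-- The `2^k`-th power of the Gowers box norm. -/
def boxPow {k : ℕ} {G : Fin k → Type*} [∀ i, Fintype (G i)] (f : (∀ i, G i) → ℂ) : ℂ :=
  cavg (fun z : (∀ i, G i) × (∀ i, G i) =>
    ∏ I : Finset (Fin k), conjIter I.card (f (fun i => if i ∈ I then z.1 i else z.2 i)))

/-- `μ` belongs to the `ε`-large multilinear spectrum of `f`. -/
def MemMLS (p : ℕ) {k : ℕ} {G : Fin k → Type*} [∀ i, Fintype (G i)] [∀ i, AddCommGroup (G i)]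
    [∀ i, Module (ZMod p) (G i)] (ε : ℝ) (f : (∀ i, G i) → ℂ)
    (μ : MultilinearMap (ZMod p) G (ZMod p)) : Prop :=
  ε ^ 2 ^ k ≤ (boxPow (fun x => f x * chi p (μ x))).re


theorem chi_eq_stdAddChar {p : ℕ} [NeZero p] (t : ZMod p) : chi p t = ZMod.stdAddChar t := by
  rw [ZMod.stdAddChar_apply, ZMod.toCircle_apply, chi, mul_div_assoc]

theorem norm_chi {p : ℕ} [NeZero p] (t : ZMod p) : ‖chi p t‖ = 1 := by
  rw [chi_eq_stdAddChar, AddChar.norm_apply]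

theorem chi_neg {p : ℕ} [NeZero p] (t : ZMod p) :
    chi p (-t) = (starRingEnd ℂ) (chi p t) := by
  rw [chi_eq_stdAddChar, chi_eq_stdAddChar, AddChar.map_neg_eq_conj]

theorem chi_sub {p : ℕ} [NeZero p] (s t : ZMod p) :
    chi p (s - t) = chi p s * (starRingEnd ℂ) (chi p t) := by
  rw [← chi_neg, sub_eq_add_neg]
  simp only [chi_eq_stdAddChar, AddChar.map_add_eq_mul]

theorem chi_sum {p : ℕ} [NeZero p] {ι : Type*} (s : Finset ι) (t : ι → ZMod p) :
    chi p (∑ i ∈ s, t i) = ∏ i ∈ s, chi p (t i) := by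
  simp only [chi_eq_stdAddChar]
  exact map_prod ZMod.stdAddChar.toMonoidHom (fun i => Multiplicative.ofAdd (t i)) s

theorem conjIter_succ (n : ℕ) (z : ℂ) : conjIter (n + 1) z = (starRingEnd ℂ) (conjIter n z) :=
  Function.iterate_succ_apply' _ _ _

theorem conjIter_mul (n : ℕ) (z w : ℂ) : conjIter n (z * w) = conjIter n z * conjIter n w := by
  induction n with
  | zero => rfl
  | succ n ih => simp only [conjIter_succ, ih, map_mul]

theorem norm_conjIter (n : ℕ) (z : ℂ) : ‖conjIter n z‖ = ‖z‖ := by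
  induction n with
  | zero => rfl
  | succ n ih => rw [conjIter_succ, RCLike.norm_conj, ih]

theorem conjIter_chi {p : ℕ} [NeZero p] (n : ℕ) (t : ZMod p) :
    conjIter n (chi p t) = chi p ((-1) ^ n * t) := by
  induction n with
  | zero => simp [conjIter]
  | succ n ih => rw [conjIter_succ, ih, ← chi_neg, pow_succ']; ring_nf

theorem multilinearMap_sub_eq_sum {R ι N : Type*} {M : ι → Type*} [CommRing R] [Fintype ι]
    [DecidableEq ι] [∀ i, AddCommGroup (M i)] [∀ i, Module R (M i)] [AddCommGroup N] [Module R N]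
    (μ : MultilinearMap R M N) (x y : ∀ i, M i) :
    μ (y - x) = ∑ I : Finset ι, (-1 : R) ^ I.card • μ (fun i => if i ∈ I then x i else y i) := by
  rw [sub_eq_neg_add, MultilinearMap.map_add_univ]
  refine Finset.sum_congr rfl fun I _ => ?_
  have h := μ.map_piecewise_smul (fun _ => (-1 : R)) (fun i => if i ∈ I then x i else y i) I
  rw [Finset.prod_const] at h
  rw [← h]
  congr 1
  ext i
  by_cases hi : i ∈ I <;> simp [hi]

/-- The phase `chi p (μ x)` contributes `chi p (μ (y - x))` to the box-norm average. -/
theorem boxPow_mul_chi {p k : ℕ} [NeZero p] {G : Fin k → Type*} [∀ i, Fintype (G i)]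
    [∀ i, AddCommGroup (G i)] [∀ i, Module (ZMod p) (G i)] (f : (∀ i, G i) → ℂ)
    (μ : MultilinearMap (ZMod p) G (ZMod p)) :
    boxPow (fun x => f x * chi p (μ x)) =
      cavg (fun z : (∀ i, G i) × (∀ i, G i) =>
        (∏ I : Finset (Fin k), conjIter I.card (f (fun i => if i ∈ I then z.1 i else z.2 i))) *
          chi p (μ (z.2 - z.1))) := by
  unfold boxPow
  congr 1
  ext z
  simp only [conjIter_mul, Finset.prod_mul_distrib, conjIter_chi, ← chi_sum,
    multilinearMap_sub_eq_sum, smul_eq_mul]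

theorem norm_cavg_le_one {α : Type*} [Fintype α] {f : α → ℂ} (hf : ∀ x, ‖f x‖ ≤ 1) :
    ‖cavg f‖ ≤ 1 := by
  rw [cavg, norm_div, Complex.norm_natCast]
  refine div_le_one_of_le₀ ?_ (Nat.cast_nonneg _)
  simpa using norm_sum_le_of_le Finset.univ fun x _ => hf x

theorem cavg_sub {A : Type*} [AddGroup A] [Fintype A] (h : A → ℂ) :
    cavg (fun z : A × A => h (z.2 - z.1)) = cavg h := by
  have hsum (x : A) : ∑ y, h (y - x) = ∑ y, h y := Equiv.sum_comp (Equiv.subRight x) h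
  have hA : (Fintype.card A : ℂ) ≠ 0 := Nat.cast_ne_zero.2 Fintype.card_ne_zero
  simp only [cavg, Fintype.sum_prod_type, hsum, Finset.sum_const, Finset.card_univ, nsmul_eq_mul,
    Fintype.card_prod, Nat.cast_mul]
  exact mul_div_mul_left _ _ hA

/-- A Bessel-type inequality for almost orthogonal unimodular functions. -/
theorem sq_mul_sq_le_of_almost_orthogonal {Z : Type*} [Fintype Z] [Nonempty Z] {n : ℕ}
    {F : Z → ℂ} (hF : ∀ z, ‖F z‖ ≤ 1) {g : Fin n → Z → ℂ} (hg : ∀ i z, ‖g i z‖ = 1)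
    {δ b : ℝ} (hδ : 0 ≤ δ) (hb : 0 ≤ b) (hcorr : ∀ i, δ ≤ (cavg (fun z => F z * g i z)).re)
    (horth : ∀ i j, i ≠ j → (cavg (fun z => g i z * (starRingEnd ℂ) (g j z))).re ≤ b) :
    (n * δ) ^ 2 ≤ n + n ^ 2 * b := by
  have hN : (0 : ℝ) < Fintype.card Z := Nat.cast_pos.2 Fintype.card_pos
  have hre (h : Z → ℂ) : (cavg h).re * Fintype.card Z = ∑ z, (h z).re := by
    rw [cavg, Complex.div_natCast_re, div_mul_cancel₀ _ hN.ne', Complex.re_sum]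
  have hlower : n * δ * Fintype.card Z ≤ ∑ z, ‖∑ i, g i z‖ := calc
    n * δ * Fintype.card Z = ∑ _i : Fin n, δ * Fintype.card Z := by simp [mul_assoc]
    _ ≤ ∑ i, ∑ z, (F z * g i z).re := by
      refine Finset.sum_le_sum fun i _ => ?_
      rw [← hre]
      exact mul_le_mul_of_nonneg_right (hcorr i) hN.le
    _ = ∑ z, (F z * ∑ i, g i z).re := by
      rw [Finset.sum_comm]
      simp only [Finset.mul_sum, Complex.re_sum]
    _ ≤ ∑ z, ‖∑ i, g i z‖ := by
      refine Finset.sum_le_sum fun z _ => (Complex.re_le_norm _).trans ?_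
      rw [norm_mul]
      exact mul_le_of_le_one_left (norm_nonneg _) (hF z)
  have hupper : ∑ z, ‖∑ i, g i z‖ ^ 2 ≤ (n + n ^ 2 * b) * Fintype.card Z := calc
    ∑ z, ‖∑ i, g i z‖ ^ 2 = ∑ z, ∑ i, ∑ j, (g i z * (starRingEnd ℂ) (g j z)).re := by
      refine Finset.sum_congr rfl fun z _ => ?_
      have h := congrArg Complex.re (Complex.mul_conj' (∑ i, g i z))
      rw [map_sum, Finset.sum_mul_sum] at h
      simp only [Complex.re_sum] at h
      rw [h]
      norm_cast
    _ = ∑ i, ∑ j, (cavg (fun z => g i z * (starRingEnd ℂ) (g j z))).re * Fintype.card Z := by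
      simp only [hre]
      rw [Finset.sum_comm]
      exact Finset.sum_congr rfl fun i _ => Finset.sum_comm
    _ ≤ ∑ i : Fin n, ∑ j : Fin n, ((if i = j then 1 else 0) + b) * Fintype.card Z := by
      refine Finset.sum_le_sum fun i _ => Finset.sum_le_sum fun j _ =>
        mul_le_mul_of_nonneg_right ?_ hN.le
      split_ifs with hij
      · refine (Complex.re_le_norm _).trans ((norm_cavg_le_one fun z => ?_).trans (by linarith))
        rw [norm_mul, RCLike.norm_conj, hg, hg, one_mul]
      · rw [zero_add]
        exact horth i j hij
    _ = (n + n ^ 2 * b) * Fintype.card Z := by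
      simp only [← Finset.sum_mul, Finset.sum_add_distrib, Finset.sum_ite_eq, Finset.mem_univ,
        if_true, Finset.sum_const, Finset.card_univ, Fintype.card_fin, nsmul_eq_mul]
      ring
  have hcs : (∑ z, ‖∑ i, g i z‖) ^ 2 ≤ Fintype.card Z * ∑ z, ‖∑ i, g i z‖ ^ 2 :=
    sq_sum_le_card_mul_sum_sq
  have h1 := pow_le_pow_left₀ (by positivity) hlower 2
  have h2 := mul_le_mul_of_nonneg_left hupper hN.le
  refine le_of_mul_le_mul_right ?_ (pow_pos hN 2)
  calc (n * δ) ^ 2 * (Fintype.card Z : ℝ) ^ 2 = (n * δ * Fintype.card Z) ^ 2 := by ring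
    _ ≤ Fintype.card Z * ((n + n ^ 2 * b) * Fintype.card Z) := h1.trans (hcs.trans h2)
    _ = _ := by ring

/-- Theorem 15, a Parseval-type bound for the large multilinear
spectrum: if `μ₁, …, μ_n` lie in the `ε`-large multilinear spectrum of a `1`-bounded
function `f` and `bias (μ_i - μ_j) ≤ b(ε) = (ε/1000)^{2^{2k+2}}` for all `i ≠ j`, then
`n < n(ε) = ⌈10 ε^{-2^{k+1}}⌉`. -/
theorem bounding_large_multilinear_spectrum
    (p k : ℕ) (hp : p.Prime) (hk : 0 < k)
    (G : Fin k → Type) [∀ i, AddCommGroup (G i)] [∀ i, Module (ZMod p) (G i)]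
    [∀ i, Fintype (G i)]
    (f : (∀ i, G i) → ℂ) (hf : ∀ x, ‖f x‖ ≤ 1)
    (ε : ℝ) (hε : 0 < ε) (n : ℕ)
    (μ : Fin n → MultilinearMap (ZMod p) G (ZMod p))
    (hmem : ∀ i, MemMLS p ε f (μ i))
    (hbias : ∀ i j, i ≠ j →
      (cavg (fun x : ∀ i, G i => chi p ((μ i - μ j) x))).re ≤
        (ε / 1000) ^ 2 ^ (2 * k + 2)) :
    n < ⌈(10 : ℝ) * (ε ^ 2 ^ (k + 1))⁻¹⌉₊ := by
  have : Fact p.Prime := ⟨hp⟩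
  rw [Nat.lt_ceil]
  have hpos : 0 < ε ^ 2 ^ (k + 1) := by positivity
  rcases Nat.eq_zero_or_pos n with rfl | hn
  · rw [Nat.cast_zero]
    positivity
  have hF (z : (∀ i, G i) × (∀ i, G i)) :
      ‖∏ I : Finset (Fin k), conjIter I.card (f (fun i => if i ∈ I then z.1 i else z.2 i))‖ ≤ 1 := by
    rw [norm_prod]
    exact Finset.prod_le_one (fun _ _ => norm_nonneg _) fun _ _ => by
      rw [norm_conjIter]
      exact hf _
  have hcorr := hmem
  simp only [MemMLS, boxPow_mul_chi] at hcorr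
  have hε1 : ε ≤ 1 := by
    refine (pow_le_one_iff_of_nonneg hε.le (by positivity)).1
      ((hcorr ⟨0, hn⟩).trans ((Complex.re_le_norm _).trans (norm_cavg_le_one fun z => ?_)))
    rw [norm_mul, norm_chi, mul_one]
    exact hF z
  have hbessel := sq_mul_sq_le_of_almost_orthogonal hF
    (g := fun i z => chi p (μ i (z.2 - z.1))) (fun _ _ => norm_chi _) (by positivity)
    (b := (ε / 1000) ^ 2 ^ (2 * k + 2)) (by positivity) hcorr fun i j hij => by
      simp only [← chi_sub, ← sub_apply]
      rw [cavg_sub fun x => chi p ((μ i - μ j) x)]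
      exact hbias i j hij
  have hb : (ε / 1000) ^ 2 ^ (2 * k + 2) ≤ ε ^ 2 ^ (k + 1) / 1000 := calc
    (ε / 1000) ^ 2 ^ (2 * k + 2) ≤ (ε / 1000) ^ 2 ^ (k + 1) :=
      pow_le_pow_of_le_one (by positivity) (by linarith)
        (Nat.pow_le_pow_right two_pos (by omega))
    _ = ε ^ 2 ^ (k + 1) * (1 / 1000) ^ 2 ^ (k + 1) := by rw [← mul_pow]; ring
    _ ≤ ε ^ 2 ^ (k + 1) * (1 / 1000) :=
      mul_le_mul_of_nonneg_left
        (pow_le_of_le_one (by norm_num) (by norm_num) (by positivity)) hpos.le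
    _ = ε ^ 2 ^ (k + 1) / 1000 := by ring
  have hnR : (0 : ℝ) < n := Nat.cast_pos.2 hn
  rw [mul_pow, ← pow_mul, ← pow_succ] at hbessel
  have hb' := mul_le_mul_of_nonneg_left hb (pow_pos hnR 2).le
  rw [← div_eq_mul_inv, lt_div_iff₀ hpos]
  nlinarith

end DGU
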